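/- In the Laplacian model, there exist constants C, c > 0 (depending on p, q, α) such that for all n and every integer r with 0 ≤ r ≤ αn, the matrix M_{(1+α)n − r} consisting of the first (1+α)n − r rows of M has full row rank (1+α)n − r over F_p with probability at least 1 − C·exp(−cr). -/

import Mathlib

open MeasureTheory

instance zmodMeasurableSpace (n : ℕ) : MeasurableSpace (ZMod n) := ⊤

/-- The Bernoulli-type measure on `ZMod p`: value `1` with probability `q`,
value `0` with probability `1 - q`. -/
noncomputable def bern (p : ℕ) (q : ℝ) : Measure (ZMod p) :=
  ENNReal.ofReal q • Measure.dirac 1 + ENNReal.ofReal (1 - q) • Measure.dirac 0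

instance bern_isFiniteMeasure (p : ℕ) (q : ℝ) : IsFiniteMeasure (bern p q) := by
  constructor
  simp [bern]

/-- Index type for the independent edge indicators of the random directed bipartite graph. -/
abbrev LapIdx (n a : ℕ) := Fin n × Fin a ⊕ Fin a × Fin n

/-- The product (Bernoulli) measure on the space of edge indicators. -/
noncomputable def lapMeasure (p n a : ℕ) (q : ℝ) : Measure (LapIdx n a → ZMod p) :=
  Measure.pi fun _ => bern p q

/-- The Laplacian of the random directed bipartite graph on parts of sizes `n` and `a`,
as a function of the edge indicators `ω`. -/
def lapM (p n a : ℕ) (ω : LapIdx n a → ZMod p) :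
    Matrix (Fin (n + a)) (Fin (n + a)) (ZMod p) := fun i j =>
  if hi : (i : ℕ) < n then
    if hj : (j : ℕ) < n then
      (if (i : ℕ) = (j : ℕ) then -∑ k : Fin a, ω (Sum.inl (⟨i, hi⟩, k)) else 0)
    else ω (Sum.inl (⟨i, hi⟩, ⟨(j : ℕ) - n, by have := j.isLt; omega⟩))
  else
    if hj : (j : ℕ) < n then
      ω (Sum.inr (⟨(i : ℕ) - n, by have := i.isLt; omega⟩, ⟨j, hj⟩))
    else
      (if (i : ℕ) = (j : ℕ) then
        -∑ k : Fin n, ω (Sum.inr (⟨(i : ℕ) - n, by have := i.isLt; omega⟩, k)) else 0)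

/-- The submatrix consisting of the first `m` rows of the Laplacian. -/
def firstRows (p n a m : ℕ) (h : m ≤ n + a) (ω : LapIdx n a → ZMod p) :
    Matrix (Fin m) (Fin (n + a)) (ZMod p) :=
  fun i j => lapM p n a ω (Fin.castLE h i) j


/-- Resampling a block of coordinates of a product measure preserves it. -/
theorem map_piecewise_prod_pi {ι F : Type*} [Fintype ι] [DecidableEq ι] [MeasurableSpace F]
    (ν : Measure F) [IsProbabilityMeasure ν] (S : Finset ι) :
    ((Measure.pi fun _ : ι => ν).prod (Measure.pi fun _ : ι => ν)).map
      (fun z => S.piecewise z.2 z.1) = Measure.pi fun _ : ι => ν := by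
  have hm : Measurable (fun z : (ι → F) × (ι → F) => S.piecewise z.2 z.1) := by
    refine measurable_pi_lambda _ fun i => ?_
    by_cases hi : i ∈ S
    · simp only [Finset.piecewise, hi, if_true]; fun_prop
    · simp only [Finset.piecewise, hi, if_false]; fun_prop
  refine (Measure.pi_eq fun s hs => ?_).symm
  rw [Measure.map_apply hm (MeasurableSet.univ_pi hs)]
  have : (fun z : (ι → F) × (ι → F) => S.piecewise z.2 z.1) ⁻¹' Set.univ.pi s =
      (Set.univ.pi fun i => if i ∈ S then Set.univ else s i) ×ˢ
        (Set.univ.pi fun i => if i ∈ S then s i else Set.univ) := by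
    ext ⟨x, y⟩
    simp only [Set.mem_preimage, Set.mem_pi, Set.mem_univ, forall_true_left, Set.mem_prod,
      Finset.piecewise, ← forall_and]
    refine forall_congr' fun i => ?_
    by_cases hi : i ∈ S <;> simp [hi]
  rw [this, Measure.prod_prod, Measure.pi_pi, Measure.pi_pi, ← Finset.prod_mul_distrib]
  refine Finset.prod_congr rfl fun i _ => ?_
  by_cases hi : i ∈ S <;> simp [hi]

/-- An event has probability at most `b` as soon as it does after resampling a block of
coordinates, whatever the other coordinates are. -/
theorem measureReal_pi_le_of_piecewise {ι F : Type*} [Fintype ι] [DecidableEq ι] [Finite F]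
    [MeasurableSpace F] [MeasurableSingletonClass F] (ν : Measure F) [IsProbabilityMeasure ν]
    (S : Finset ι) (A : Set (ι → F)) {b : ℝ} (hb : 0 ≤ b)
    (h : ∀ x ∈ A, (Measure.pi fun _ : ι => ν).real {y | S.piecewise y x ∈ A} ≤ b) :
    (Measure.pi fun _ : ι => ν).real A ≤ b := by
  have key : ∀ x, (Measure.pi fun _ : ι => ν) {y | S.piecewise y x ∈ A} ≤ ENNReal.ofReal b := by
    intro x
    rcases Set.eq_empty_or_nonempty {y | S.piecewise y x ∈ A} with he | ⟨y₀, hy₀⟩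
    · simp [he]
    · have := h _ hy₀
      have e : {y | S.piecewise y (S.piecewise y₀ x) ∈ A} = {y | S.piecewise y x ∈ A} := by
        ext y
        simp
      rw [e] at this
      exact (ENNReal.le_ofReal_iff_toReal_le (measure_ne_top _ _) hb).2 this
  refine ENNReal.toReal_le_of_le_ofReal hb ?_
  conv_lhs => rw [← map_piecewise_prod_pi ν S]
  rw [Measure.map_apply (measurable_of_countable _) (Set.toFinite _).measurableSet,
    Measure.prod_apply (Set.toFinite _).measurableSet]
  calc _ ≤ ∫⁻ _, ENNReal.ofReal b ∂(Measure.pi fun _ : ι => ν) := lintegral_mono fun x => key x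
    _ = _ := by simp

/-- Odlyzko's bound: a linear system of rank `d` has a given right hand side with probability
at most `θ ^ d` when the atoms of the coordinates have mass at most `θ = exp (-κ)`. -/
theorem measureReal_pi_linearMap_eq_le {ι F U : Type*} [Fintype ι] [DecidableEq ι] [Field F]
    [Finite F] [MeasurableSpace F] [MeasurableSingletonClass F] (ν : Measure F)
    [IsProbabilityMeasure ν] {κ : ℝ} (hν : ∀ t, ν.real {t} ≤ Real.exp (-κ))
    [AddCommGroup U] [Module F U] (L : (ι → F) →ₗ[F] U) (u : U) :
    (Measure.pi fun _ : ι => ν).real {y | L y = u} ≤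
      Real.exp (-κ * Module.finrank F (LinearMap.range L)) := by
  classical
  obtain ⟨B, b, hinj, hspan, hli⟩ :=
    exists_linearIndependent' F (fun i : ι => L (Pi.single i 1))
  have : Finite B := Finite.of_injective b hinj
  have := Fintype.ofFinite B
  have hrange : Submodule.span F (Set.range fun i : ι => L (Pi.single i 1)) =
      LinearMap.range L := by
    have := (Pi.basisFun F ι).span_eq
    rw [LinearMap.range_eq_map, ← this, Submodule.map_span, ← Set.range_comp]
    congr 1
    ext; simp
  have hcard : Module.finrank F (LinearMap.range L) = Fintype.card B := by
    rw [← hrange, ← hspan, finrank_span_eq_card hli]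
  set S : Finset ι := Finset.univ.map ⟨b, hinj⟩ with hS
  refine measureReal_pi_le_of_piecewise ν S _ (Real.exp_nonneg _) fun x hx => ?_
  have hsub : {y | S.piecewise y x ∈ {y | L y = u}} ⊆
      Set.univ.pi fun i => if i ∈ S then {x i} else Set.univ := by
    intro y hy
    simp only [Set.mem_ofPred_eq] at hy hx
    have h0 : L (S.piecewise y x - x) = 0 := by rw [map_sub, hy, hx, sub_self]
    have h1 : S.piecewise y x - x = ∑ i : B, (y (b i) - x (b i)) • Pi.single (b i) (1 : F) := by
      ext i
      simp only [Pi.sub_apply, Finset.sum_apply, Pi.smul_apply, smul_eq_mul]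
      by_cases hi : i ∈ S
      · obtain ⟨j, -, rfl⟩ := Finset.mem_map.1 hi
        rw [Finset.piecewise_eq_of_mem _ _ _ hi, Finset.sum_eq_single j]
        · simp
        · intro k _ hk
          simp [hinj.eq_iff, Ne.symm hk]
        · simp
      · rw [Finset.piecewise_eq_of_notMem _ _ _ hi, Finset.sum_eq_zero, sub_self]
        intro k _
        have : i ≠ b k := by rintro rfl; exact hi (Finset.mem_map.2 ⟨k, Finset.mem_univ _, rfl⟩)
        simp [this]
    rw [h1, map_sum] at h0
    simp only [map_smul] at h0
    have h2 := Fintype.linearIndependent_iff.1 hli _ h0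
    intro i _
    by_cases hi : i ∈ S
    · obtain ⟨j, -, rfl⟩ := Finset.mem_map.1 hi
      have := h2 j
      simp_all [sub_eq_zero]
    · simp [hi]
  refine (measureReal_mono hsub).trans ?_
  rw [measureReal_def, Measure.pi_pi, ENNReal.toReal_prod, hcard]
  calc ∏ i, (ν (if i ∈ S then {x i} else Set.univ)).toReal
      ≤ ∏ i, (if i ∈ S then Real.exp (-κ) else 1) := by
        refine Finset.prod_le_prod (fun _ _ => ENNReal.toReal_nonneg) fun i _ => ?_
        by_cases hi : i ∈ S
        · simpa only [hi, if_true, ← measureReal_def] using hν (x i)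
        · simp [hi]
    _ = Real.exp (-κ * Fintype.card B) := by
        rw [Finset.prod_ite_mem, Finset.univ_inter, Finset.prod_const, hS, Finset.card_map,
          Finset.card_univ, ← Real.exp_nat_mul, mul_comm]

/-- If `V` is a subspace that does not depend on the coordinates in the block `e`, then the block
lies in `V` while `V` has codimension at least `d` with probability at most `exp (-κ d)`. -/
theorem measureReal_pi_block_mem_le {ι η F : Type*} [Fintype ι] [DecidableEq ι] [Fintype η]
    [Field F] [Finite F] [MeasurableSpace F] [MeasurableSingletonClass F] (ν : Measure F)
    [IsProbabilityMeasure ν] {κ : ℝ} (hκ : 0 ≤ κ) (hν : ∀ t, ν.real {t} ≤ Real.exp (-κ))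
    (e : η ↪ ι) (V : (ι → F) → Submodule F (η → F))
    (hV : ∀ x y : ι → F, (∀ i ∉ Set.range e, x i = y i) → V x = V y) (d : ℝ) :
    (Measure.pi fun _ : ι => ν).real
      {x | x ∘ e ∈ V x ∧ d ≤ Module.finrank F ((η → F) ⧸ V x)} ≤ Real.exp (-κ * d) := by
  set S : Finset ι := Finset.univ.map e with hS
  have hVS : ∀ x y, V (S.piecewise y x) = V x := by
    intro x y
    refine hV _ _ fun i hi => ?_
    refine Finset.piecewise_eq_of_notMem _ _ _ fun h => hi ?_
    obtain ⟨j, -, rfl⟩ := Finset.mem_map.1 h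
    exact ⟨j, rfl⟩
  refine measureReal_pi_le_of_piecewise ν S _ (Real.exp_nonneg _) fun x hx => ?_
  have hsurj : Function.Surjective ((V x).mkQ ∘ₗ LinearMap.funLeft F F e) := by
    rw [LinearMap.coe_comp]
    exact (Submodule.mkQ_surjective _).comp (LinearMap.funLeft_surjective_of_injective _ _ _ e.2)
  have h := measureReal_pi_linearMap_eq_le ν hν ((V x).mkQ ∘ₗ LinearMap.funLeft F F e) 0
  rw [LinearMap.range_eq_top.2 hsurj, finrank_top] at h
  refine (measureReal_mono ?_).trans (h.trans (Real.exp_le_exp.2 ?_))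
  · rintro y ⟨hy, -⟩
    rw [hVS] at hy
    have : (S.piecewise y x) ∘ e = y ∘ e := by
      ext j
      exact Finset.piecewise_eq_of_mem _ _ _ (Finset.mem_map_of_mem e (Finset.mem_univ j))
    rw [this] at hy
    simpa [LinearMap.funLeft] using hy
  · nlinarith [hx.2]

theorem bern_isProbabilityMeasure (p : ℕ) {q : ℝ} (hq0 : 0 < q) (hq1 : q < 1) :
    IsProbabilityMeasure (bern p q) := by
  constructor
  simp [bern, ← ENNReal.ofReal_add hq0.le (sub_nonneg.2 hq1.le)]

theorem exists_bern_singleton_le (p : ℕ) [Fact p.Prime] {q : ℝ} (hq0 : 0 < q) (hq1 : q < 1) :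
    ∃ κ > (0 : ℝ), ∀ t, (bern p q).real {t} ≤ Real.exp (-κ) := by
  refine ⟨-Real.log (max q (1 - q)), ?_, fun t => ?_⟩
  · exact neg_pos.2 (Real.log_neg (lt_max_of_lt_left hq0) (max_lt hq1 (by linarith)))
  · rw [neg_neg, Real.exp_log (lt_max_of_lt_left hq0)]
    refine ENNReal.toReal_le_of_le_ofReal (le_max_of_le_left hq0.le) ?_
    have h01 : (0 : ZMod p) ≠ 1 := zero_ne_one
    simp only [bern, Measure.add_apply, Measure.smul_apply, smul_eq_mul, measurableSet_singleton,
      Measure.dirac_apply', Set.indicator_apply, Set.mem_singleton_iff, Pi.one_apply]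
    by_cases h1 : (1 : ZMod p) = t
    · subst h1
      simp [h01]
    · by_cases h0 : (0 : ZMod p) = t
      · subst h0
        simp
      · simp [h0, h1]

theorem integral_bern (p : ℕ) [Fact p.Prime] {q : ℝ} (hq0 : 0 < q) (hq1 : q < 1)
    (f : ZMod p → ℂ) : ∫ x, f x ∂bern p q = q * f 1 + (1 - q) * f 0 := by
  rw [bern, integral_add_measure
    (Integrable.of_finite.smul_measure ENNReal.ofReal_ne_top)
    (Integrable.of_finite.smul_measure ENNReal.ofReal_ne_top), integral_smul_measure,
    integral_smul_measure, integral_dirac, integral_dirac,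
    ENNReal.toReal_ofReal hq0.le, ENNReal.toReal_ofReal (sub_nonneg.2 hq1.le)]
  simp

/-- A nontrivial convex combination of `1` and another point of the unit circle lies in the open
unit disc. -/
theorem norm_convex_combination_one_lt {q : ℝ} (hq0 : 0 < q) (hq1 : q < 1) {z : ℂ}
    (hz : ‖z‖ = 1) (hz1 : z ≠ 1) : ‖(q : ℂ) * z + (1 - q) * 1‖ < 1 := by
  have := (strictConvex_closedBall ℝ (0 : ℂ) 1) (x := z) (by simp [hz]) (y := 1) (by simp) hz1
    hq0 (sub_pos.2 hq1) (by ring)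
  rw [interior_closedBall _ one_ne_zero] at this
  simpa using this

/-- The sum of `a` independent Bernoulli variables equidistributes modulo `p`. -/
theorem tendsto_pi_bern_sum_eq_zero (p : ℕ) [Fact p.Prime] {q : ℝ} (hq0 : 0 < q) (hq1 : q < 1) :
    Filter.Tendsto (fun a : ℕ => (Measure.pi fun _ : Fin a => bern p q).real {x | ∑ k, x k = 0})
      Filter.atTop (nhds (1 / (p : ℝ))) := by
  have := bern_isProbabilityMeasure p hq0 hq1
  let ψ : AddChar (ZMod p) ℂ := ZMod.stdAddChar
  have hψ : ψ.IsPrimitive := ZMod.isPrimitive_stdAddChar p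
  have hp : (p : ℂ) ≠ 0 := by exact_mod_cast (Fact.out : p.Prime).ne_zero
  have hψsum : ∀ {a : ℕ} (t : ZMod p) (x : Fin a → ZMod p),
      ψ (t * ∑ k, x k) = ∏ k, ψ (t * x k) := by
    intro a t x
    rw [Finset.mul_sum]
    induction (Finset.univ : Finset (Fin a)) using Finset.induction_on with
    | empty => simp
    | insert i s hi ih => rw [Finset.sum_insert hi, Finset.prod_insert hi, AddChar.map_add_eq_mul, ih]
  have key : ∀ a : ℕ, (((Measure.pi fun _ : Fin a => bern p q).real {x | ∑ k, x k = 0} : ℝ) : ℂ) =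
      (1 / p) * ∑ t : ZMod p, (q * ψ t + (1 - q) * 1) ^ a := by
    intro a
    have hind : ∀ x : Fin a → ZMod p, Set.indicator {x | ∑ k, x k = 0} (fun _ => (1 : ℂ)) x =
        (1 / p) * ∑ t : ZMod p, ∏ k, ψ (t * x k) := by
      intro x
      simp only [← hψsum, AddChar.sum_mulShift _ hψ, ZMod.card, Set.indicator_apply,
        Set.mem_ofPred_eq]
      split_ifs <;> simp [hp]
    have h1 : (((Measure.pi fun _ : Fin a => bern p q).real {x | ∑ k, x k = 0} : ℝ) : ℂ) =
        ∫ x, Set.indicator {x | ∑ k, x k = 0} (fun _ => (1 : ℂ)) x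
          ∂(Measure.pi fun _ : Fin a => bern p q) := by
      rw [integral_indicator (Set.toFinite _).measurableSet]
      simp
    rw [h1]
    simp_rw [hind]
    rw [integral_const_mul, integral_finsetSum _ fun _ _ => .of_finite]
    congr 1
    refine Finset.sum_congr rfl fun t _ => ?_
    rw [integral_fintype_prod_eq_pow (fun x => ψ (t * x)), integral_bern p hq0 hq1]
    simp
  have hlim : Filter.Tendsto (fun a : ℕ => (1 / (p : ℂ)) *
      ∑ t : ZMod p, (q * ψ t + (1 - q) * 1) ^ a) Filter.atTop
      (nhds ((1 / (p : ℂ)) * ∑ t : ZMod p, if t = 0 then 1 else 0)) := by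
    refine (tendsto_finsetSum _ fun t _ => ?_).const_mul _
    by_cases ht : t = 0
    · refine tendsto_const_nhds.congr fun a => ?_
      simp [ht]
    · rw [if_neg ht]
      refine tendsto_pow_atTop_nhds_zero_of_norm_lt_one
        (norm_convex_combination_one_lt hq0 hq1 (ψ.norm_apply t) fun h => ht ?_)
      exact ZMod.injective_stdAddChar (by simpa [ψ] using h)
  simp_rw [← key] at hlim
  have := (Complex.continuous_re.tendsto _).comp hlim
  simp only [Function.comp_def, Complex.ofReal_re] at this
  simpa using this

/-- Hoeffding's inequality for the number of coordinates of a product measure in a given set. -/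
theorem measureReal_pi_card_ge_le {E : Type*} [MeasurableSpace E] (ρ : Measure E)
    [IsProbabilityMeasure ρ] {Z : Set E} (hZ : MeasurableSet Z) [DecidablePred (· ∈ Z)] (n : ℕ)
    {b ε : ℝ} (hε : 0 ≤ ε) (hb : ρ.real Z ≤ b) :
    (Measure.pi fun _ : Fin n => ρ).real
      {x | (b + ε) * n ≤ (Finset.univ.filter fun i => x i ∈ Z).card} ≤
      Real.exp (-(2 * ε ^ 2) * n) := by
  rcases Nat.eq_zero_or_pos n with rfl | hn
  · simp
  let g : E → ℝ := Z.indicator 1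
  have hg : Measurable g := measurable_one.indicator hZ
  have hev : ∀ i : Fin n, ∫ x : Fin n → E, g (x i) ∂(Measure.pi fun _ : Fin n => ρ) = ρ.real Z := by
    intro i
    have h := integral_map (μ := Measure.pi fun _ : Fin n => ρ) (φ := Function.eval i) (f := g)
      (measurable_pi_apply i).aemeasurable hg.aestronglyMeasurable
    rw [(measurePreserving_eval (fun _ : Fin n => ρ) i).map_eq] at h
    simpa [g, integral_indicator_one hZ] using h.symm
  have hsub : ∀ i ∈ (Finset.univ : Finset (Fin n)), ProbabilityTheory.HasSubgaussianMGF
      (fun x : Fin n → E => g (x i) - ρ.real Z) ((‖(1 : ℝ) - 0‖₊ / 2) ^ 2)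
      (Measure.pi fun _ : Fin n => ρ) := by
    intro i _
    have := ProbabilityTheory.hasSubgaussianMGF_of_mem_Icc (μ := Measure.pi fun _ : Fin n => ρ)
      (X := fun x => g (x i)) (a := 0) (b := 1)
      (hg.comp (measurable_pi_apply i)).aemeasurable
      (Filter.Eventually.of_forall fun x => by
        by_cases h : x i ∈ Z <;> simp [g, h])
    rwa [hev i] at this
  have h := ProbabilityTheory.HasSubgaussianMGF.measure_sum_ge_le_of_iIndepFun
    (ProbabilityTheory.iIndepFun_pi (μ := fun _ : Fin n => ρ) (X := fun _ y => g y - ρ.real Z)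
      fun _ => (hg.sub_const _).aemeasurable) hsub (ε := ε * n) (by positivity)
  refine (measureReal_mono fun x hx => ?_).trans (h.trans (Real.exp_le_exp.2 (le_of_eq ?_)))
  · have hsum : ∑ i, g (x i) = (Finset.univ.filter fun i => x i ∈ Z).card := by
      simp [g, Set.indicator_apply]
    simp only [Set.mem_ofPred_eq, Finset.sum_sub_distrib, hsum] at hx ⊢
    have : ρ.real Z * n ≤ b * n := by gcongr
    simp only [Finset.sum_const, Finset.card_univ, Fintype.card_fin, nsmul_eq_mul]
    linarith
  · have : (n : ℝ) ≠ 0 := by positivity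
    simp
    field_simp

/-- The out-edge indicators of the first part, read row by row, form independent Bernoulli
vectors. -/
theorem map_inl_lapMeasure (p n a : ℕ) {q : ℝ} (hq0 : 0 < q) (hq1 : q < 1) :
    (lapMeasure p n a q).map (fun ω i k => ω (Sum.inl (i, k))) =
      Measure.pi fun _ : Fin n => Measure.pi fun _ : Fin a => bern p q := by
  have := bern_isProbabilityMeasure p hq0 hq1
  simp only [lapMeasure, ← Measure.infinitePi_eq_pi]
  have hinl := Measure.map_infinitePi_infinitePi_of_inj (P := fun _ : LapIdx n a => bern p q)
    (Sum.inl_injective (α := Fin n × Fin a) (β := Fin a × Fin n))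
  rw [← Measure.infinitePi_map_curry fun (_ : Fin n) (_ : Fin a) => bern p q, ← hinl,
    Measure.map_map (by fun_prop) (by fun_prop)]
  rfl

theorem exists_forall_card_rowSum_eq_zero_le (p : ℕ) [Fact p.Prime] {q : ℝ} (hq0 : 0 < q)
    (hq1 : q < 1) {ε : ℝ} (hε : 0 < ε) :
    ∃ a₀ : ℕ, ∀ a ≥ a₀, ∀ n : ℕ, (lapMeasure p n a q).real
      {ω | (1 / p + ε) * n ≤
        (Finset.univ.filter fun i : Fin n => ∑ k, ω (Sum.inl (i, k)) = 0).card} ≤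
      Real.exp (-(ε ^ 2 / 2) * n) := by
  have := bern_isProbabilityMeasure p hq0 hq1
  obtain ⟨a₀, h⟩ := Filter.eventually_atTop.1 ((tendsto_pi_bern_sum_eq_zero p hq0 hq1).eventually_le_const
    (u := 1 / p + ε / 2) (by linarith))
  refine ⟨a₀, fun a ha n => ?_⟩
  have h2 := measureReal_pi_card_ge_le (Measure.pi fun _ : Fin a => bern p q)
    (Set.toFinite {x : Fin a → ZMod p | ∑ k, x k = 0}).measurableSet n (half_pos hε).le (h a ha)
  rw [← map_inl_lapMeasure p n a hq0 hq1, map_measureReal_apply (by fun_prop)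
    (Set.toFinite _).measurableSet] at h2
  convert h2 using 2
  · ext ω
    simp [add_assoc]
  · ring

/-- Vectors indexed by `Fin m`, none of which lies in the span of its predecessors, are linearly
independent. -/
theorem linearIndependent_of_forall_notMem_span_lt {F E : Type*} [Field F] [AddCommGroup E]
    [Module F E] {m : ℕ} (v : Fin m → E)
    (h : ∀ k, v k ∉ Submodule.span F (v '' {l | l < k})) : LinearIndependent F v := by
  induction m with
  | zero => exact linearIndependent_empty_type
  | succ m ih =>
    refine linearIndependent_finSucc'.2 ⟨ih _ fun k hk => h k.castSucc ?_, fun hk => h (Fin.last m) ?_⟩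
    · refine Submodule.span_mono ?_ hk
      rintro _ ⟨l, hl, rfl⟩
      exact ⟨l.castSucc, by simpa using hl, rfl⟩
    · refine Submodule.span_mono ?_ hk
      rintro _ ⟨l, rfl⟩
      exact ⟨l.castSucc, Fin.castSucc_lt_last l, rfl⟩

theorem finrank_span_image_finset_le {F E ι : Type*} [Field F] [AddCommGroup E] [Module F E]
    (v : ι → E) (s : Finset ι) : Module.finrank F (Submodule.span F (v '' s)) ≤ s.card := by
  classical
  rw [← Finset.coe_image]
  exact (finrank_span_finset_le_card _).trans Finset.card_image_le

/-- If the coordinates `φ` of the vectors `w` form a diagonal matrix with diagonal `D`, then a vector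
`w k` that depends on the vectors indexed by `s ∌ k` depends modulo the coordinates `φ` only on
those with vanishing diagonal entry. -/
theorem map_mem_span_of_diagonal {F G E ι : Type*} [Field F] [AddCommGroup G] [Module F G]
    [AddCommGroup E] [Module F E] [Fintype ι] [DecidableEq ι] (w : ι → G) (φ : ι → G →ₗ[F] F)
    (π : G →ₗ[F] E) (D : ι → F) (hφ : ∀ l m, φ l (w m) = if l = m then D l else 0) {s : Set ι}
    {k : ι} (hk : k ∉ s) (h : w k ∈ Submodule.span F (w '' s)) :
    π (w k) ∈ Submodule.span F ((fun l => π (w l)) '' {l | l ∈ s ∧ D l = 0}) := by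
  classical
  let Φ : G →ₗ[F] E :=
    π - ∑ l, (if l ∈ s then (D l)⁻¹ else 0) • (φ l).smulRight (π (w l))
  have hΦ : ∀ m, Φ (w m) = π (w m) - (if m ∈ s then (D m)⁻¹ else 0) • D m • π (w m) := by
    intro m
    simp only [Φ, LinearMap.sub_apply, LinearMap.sum_apply, LinearMap.smul_apply,
      LinearMap.smulRight_apply, hφ]
    rw [Finset.sum_eq_single m]
    · simp
    · intro l _ hl
      simp [hl]
    · simp
  have hle : Submodule.span F (w '' s) ≤
      (Submodule.span F ((fun l => π (w l)) '' {l | l ∈ s ∧ D l = 0})).comap Φ := by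
    rw [Submodule.span_le]
    rintro _ ⟨l, hl, rfl⟩
    rw [SetLike.mem_coe, Submodule.mem_comap, hΦ, if_pos hl]
    by_cases hD : D l = 0
    · simpa [hD] using Submodule.subset_span (s := (fun l => π (w l)) '' {l | l ∈ s ∧ D l = 0})
        ⟨l, ⟨hl, hD⟩, rfl⟩
    · simp [smul_smul, hD]
  simpa [hΦ, hk] using hle h

theorem finrank_comap_add_finrank_map_le {F H G E : Type*} [Field F] [AddCommGroup H] [Module F H]
    [AddCommGroup G] [Module F G] [FiniteDimensional F G] [AddCommGroup E] [Module F E]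
    (f : H →ₗ[F] G) (hf : Function.Injective f) (π : G →ₗ[F] E) (hπ : ∀ x, π (f x) = 0)
    (W : Submodule F G) :
    Module.finrank F (W.comap f) + Module.finrank F (W.map π) ≤ Module.finrank F W := by
  have h := LinearMap.finrank_range_add_finrank_ker (π.domRestrict W)
  rw [LinearMap.range_domRestrict] at h
  have hle : Module.finrank F (W.comap f) ≤ Module.finrank F (LinearMap.ker (π.domRestrict W)) :=
    LinearMap.finrank_le_finrank_of_injective
      (f := (f.restrict (p := W.comap f) (q := W) fun _ hx => hx).codRestrict _
        fun x => LinearMap.mem_ker.2 (hπ x))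
      fun x y hxy => Subtype.ext (hf (congrArg (fun z => (z : W).1) (congrArg Subtype.val hxy)))
  omega

section Rows

variable {p n a : ℕ}

theorem castAdd_ne_natAdd (i : Fin n) (k : Fin a) : i.castAdd a ≠ k.natAdd n := fun h => by
  have := congrArg Fin.val h
  rw [Fin.val_castAdd, Fin.val_natAdd] at this
  omega

theorem lapM_castAdd_castAdd (ω : LapIdx n a → ZMod p) (i l : Fin n) :
    lapM p n a ω (i.castAdd a) (l.castAdd a) =
      if i = l then -∑ k, ω (Sum.inl (i, k)) else 0 := by
  simp [lapM, Fin.ext_iff]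

theorem lapM_castAdd_natAdd (ω : LapIdx n a → ZMod p) (i : Fin n) (k : Fin a) :
    lapM p n a ω (i.castAdd a) (k.natAdd n) = ω (Sum.inl (i, k)) := by
  simp [lapM]

theorem lapM_natAdd_castAdd (ω : LapIdx n a → ZMod p) (j : Fin a) (i : Fin n) :
    lapM p n a ω (j.natAdd n) (i.castAdd a) = ω (Sum.inr (j, i)) := by
  simp [lapM]

theorem lapM_natAdd_natAdd (ω : LapIdx n a → ZMod p) (j k : Fin a) :
    lapM p n a ω (j.natAdd n) (k.natAdd n) =
      if j = k then -∑ i, ω (Sum.inr (j, i)) else 0 := by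
  simp [lapM, Fin.ext_iff]

/-- The edge indicators out of vertex `i` of the first part. -/
def outBlock (i : Fin n) : Fin a ↪ LapIdx n a :=
  ⟨fun k => Sum.inl (i, k), fun _ _ h => by simpa using h⟩

/-- The edge indicators into vertex `k` of the second part. -/
def colBlock (k : Fin a) : Fin n ↪ LapIdx n a :=
  ⟨fun i => Sum.inl (i, k), fun _ _ h => by simpa using h⟩

/-- The edge indicators out of vertex `j` of the second part. -/
def inBlock (j : Fin a) : Fin n ↪ LapIdx n a :=
  ⟨fun i => Sum.inr (j, i), fun _ _ h => by simpa using h⟩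

@[simp] theorem outBlock_apply (i : Fin n) (k : Fin a) : outBlock i k = Sum.inl (i, k) := rfl

@[simp] theorem colBlock_apply (k : Fin a) (i : Fin n) : colBlock k i = Sum.inl (i, k) := rfl

@[simp] theorem inBlock_apply (j : Fin a) (i : Fin n) : inBlock j i = Sum.inr (j, i) := rfl

/-- The span of the rows of the upper right block before row `i` whose sum vanishes. -/
def outSpan [Fact p.Prime] (i : Fin n) (ω : LapIdx n a → ZMod p) :
    Submodule (ZMod p) (Fin a → ZMod p) :=
  Submodule.span _ ((fun l => ω ∘ outBlock l) '' {l | l < i ∧ ∑ k, ω (Sum.inl (l, k)) = 0})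

/-- The span of the columns of the upper right block before column `k`. -/
def colSpan [Fact p.Prime] (k : Fin a) (ω : LapIdx n a → ZMod p) :
    Submodule (ZMod p) (Fin n → ZMod p) :=
  Submodule.span _ ((fun l => ω ∘ colBlock l) '' {l | l < k})

/-- The span of the rows of the Laplacian before row `n + j`, together with the coordinate vector
of the diagonal entry of that row. -/
noncomputable def rowSpan [Fact p.Prime] (j : Fin a) (ω : LapIdx n a → ZMod p) :
    Submodule (ZMod p) (Fin (n + a) → ZMod p) :=
  Submodule.span _ (lapM p n a ω '' {l | l < j.natAdd n}) ⊔
    Submodule.span _ {Pi.single (j.natAdd n) 1}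

/-- The vectors in `rowSpan` supported on the first part. -/
noncomputable def inSpan [Fact p.Prime] (j : Fin a) (ω : LapIdx n a → ZMod p) :
    Submodule (ZMod p) (Fin n → ZMod p) :=
  (rowSpan j ω).comap (Function.ExtendByZero.linearMap (ZMod p) (Fin.castAdd a))

variable [Fact p.Prime]

theorem outSpan_congr (i : Fin n) (x y : LapIdx n a → ZMod p)
    (h : ∀ t ∉ Set.range (outBlock i), x t = y t) : outSpan i x = outSpan i y := by
  have h' : ∀ l < i, ∀ k, x (Sum.inl (l, k)) = y (Sum.inl (l, k)) := fun l hl k =>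
    h _ (by simp [hl.ne'])
  have hs : {l | l < i ∧ ∑ k, x (Sum.inl (l, k)) = 0} =
      {l | l < i ∧ ∑ k, y (Sum.inl (l, k)) = 0} := by
    ext l
    refine and_congr_right fun hl => ?_
    simp [h' l hl]
  rw [outSpan, outSpan, hs]
  congr 1
  refine Set.image_congr fun l hl => ?_
  ext k
  exact h' l hl.1 k

theorem colSpan_congr (k : Fin a) (x y : LapIdx n a → ZMod p)
    (h : ∀ t ∉ Set.range (colBlock k), x t = y t) : colSpan k x = colSpan k y := by
  rw [colSpan, colSpan]
  congr 1
  refine Set.image_congr fun l hl => ?_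
  ext i
  have hne : k ≠ l := (show l < k from hl).ne'
  exact h _ (by simp [hne])

theorem inSpan_congr (j : Fin a) (x y : LapIdx n a → ZMod p)
    (h : ∀ t ∉ Set.range (inBlock j), x t = y t) : inSpan j x = inSpan j y := by
  rw [inSpan, inSpan, rowSpan, rowSpan]
  congr 3
  refine Set.image_congr fun l hl => ?_
  have hinl : ∀ z, x (Sum.inl z) = y (Sum.inl z) := fun z => h _ (by simp)
  ext m
  refine Fin.addCases (fun i hl => ?_) (fun j' hl => ?_) l hl
  · refine Fin.addCases (fun i' => ?_) (fun k => ?_) m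
    · simp [lapM_castAdd_castAdd, hinl]
    · simp [lapM_castAdd_natAdd, hinl]
  · have hne : j ≠ j' := by
      rintro rfl
      exact lt_irrefl (Fin.natAdd n j) hl
    have hinr : ∀ i, x (Sum.inr (j', i)) = y (Sum.inr (j', i)) := fun i =>
      h _ (by simp [hne])
    refine Fin.addCases (fun i' => ?_) (fun k => ?_) m
    · simp [lapM_natAdd_castAdd, hinr]
    · simp [lapM_natAdd_natAdd, hinr]

theorem notMem_outSpan_imp (ω : LapIdx n a → ZMod p) (i : Fin n)
    (h : ω ∘ outBlock i ∉ outSpan i ω) :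
    lapM p n a ω (i.castAdd a) ∉
      Submodule.span (ZMod p) (lapM p n a ω '' {l | l < i.castAdd a}) := by
  intro hi
  have hset : lapM p n a ω '' {l | l < i.castAdd a} =
      (fun l : Fin n => lapM p n a ω (l.castAdd a)) '' {l | l < i} := by
    ext z
    constructor
    · rintro ⟨l, hl, rfl⟩
      refine ⟨⟨l, hl.trans i.2⟩, hl, rfl⟩
    · rintro ⟨l, hl, rfl⟩
      exact ⟨_, hl, rfl⟩
  rw [hset] at hi
  have := map_mem_span_of_diagonal (fun l : Fin n => lapM p n a ω (l.castAdd a))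
    (fun l => LinearMap.proj (l.castAdd a)) (LinearMap.funLeft (ZMod p) (ZMod p) (Fin.natAdd n))
    (fun l => -∑ k, ω (Sum.inl (l, k)))
    (fun l m => by
      rw [LinearMap.proj_apply, lapM_castAdd_castAdd]
      by_cases hlm : l = m
      · simp [hlm]
      · simp [hlm, Ne.symm hlm])
    (s := {l | l < i}) (k := i) (by simp) hi
  have hX : ∀ l : Fin n, LinearMap.funLeft (ZMod p) (ZMod p) (Fin.natAdd n)
      (lapM p n a ω (l.castAdd a)) = ω ∘ outBlock l := by
    intro l
    ext k
    exact lapM_castAdd_natAdd ω l k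
  simp only [hX, neg_eq_zero, Set.mem_ofPred_eq] at this
  exact h this

theorem notMem_inSpan_imp (ω : LapIdx n a → ZMod p) (j : Fin a)
    (h : ω ∘ inBlock j ∉ inSpan j ω) :
    lapM p n a ω (j.natAdd n) ∉
      Submodule.span (ZMod p) (lapM p n a ω '' {l | l < j.natAdd n}) := by
  intro hj
  refine h ?_
  have heq : Function.ExtendByZero.linearMap (ZMod p) (Fin.castAdd a) (ω ∘ inBlock j) =
      lapM p n a ω (j.natAdd n) + (∑ i, ω (Sum.inr (j, i))) • Pi.single (j.natAdd n) 1 := by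
    ext m
    refine Fin.addCases (fun i => ?_) (fun k => ?_) m
    · simp [lapM_natAdd_castAdd, castAdd_ne_natAdd, (Fin.castAdd_injective n a).extend_apply]
    · have h0 : Function.ExtendByZero.linearMap (ZMod p) (Fin.castAdd a) (ω ∘ inBlock j)
          (k.natAdd n) = 0 :=
        Function.extend_apply' _ _ _ fun ⟨i, hi⟩ => castAdd_ne_natAdd i k hi
      rw [h0, Pi.add_apply, lapM_natAdd_natAdd]
      by_cases hjk : j = k
      · simp [hjk]
      · simp [hjk, Ne.symm hjk]
  rw [inSpan, Submodule.mem_comap, heq]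
  exact Submodule.add_mem_sup hj
    (Submodule.smul_mem _ _ (Submodule.mem_span_singleton_self _))

/-- The upper right block of the Laplacian. -/
def upperRight (ω : LapIdx n a → ZMod p) : Matrix (Fin n) (Fin a) (ZMod p) :=
  fun i k => ω (Sum.inl (i, k))

theorem le_finrank_quotient_outSpan (ω : LapIdx n a → ZMod p) (i : Fin n) :
    a ≤ Module.finrank (ZMod p) ((Fin a → ZMod p) ⧸ outSpan i ω) +
      (Finset.univ.filter fun i : Fin n => ∑ k, ω (Sum.inl (i, k)) = 0).card := by
  have h := Submodule.finrank_quotient_add_finrank (outSpan i ω)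
  rw [Module.finrank_fin_fun] at h
  have h2 := finrank_span_image_finset_le (F := ZMod p) (fun l => ω ∘ outBlock l)
    (Finset.univ.filter fun i : Fin n => ∑ k, ω (Sum.inl (i, k)) = 0)
  have h3 : outSpan i ω ≤ Submodule.span (ZMod p) ((fun l => ω ∘ outBlock l) ''
    (Finset.univ.filter fun i : Fin n => ∑ k, ω (Sum.inl (i, k)) = 0 : Finset (Fin n))) :=
    Submodule.span_mono (Set.image_mono fun l hl => by simpa using hl.2)
  have h4 := Submodule.finrank_mono h3
  omega

theorem le_finrank_quotient_colSpan (ω : LapIdx n a → ZMod p) (k : Fin a) :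
    n ≤ Module.finrank (ZMod p) ((Fin n → ZMod p) ⧸ colSpan k ω) + k := by
  have h := Submodule.finrank_quotient_add_finrank (colSpan k ω)
  rw [Module.finrank_fin_fun] at h
  have h2 := finrank_span_image_finset_le (F := ZMod p) (fun l => ω ∘ colBlock l) (Finset.Iio k)
  rw [Finset.coe_Iio, Fin.card_Iio] at h2
  have : Module.finrank (ZMod p) (colSpan k ω) ≤ k := h2
  omega

theorem le_finrank_quotient_inSpan (ω : LapIdx n a → ZMod p) (j : Fin a) :
    (upperRight ω).rank ≤
      Module.finrank (ZMod p) ((Fin n → ZMod p) ⧸ inSpan j ω) + (j + 1) := by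
  have h := Submodule.finrank_quotient_add_finrank (inSpan j ω)
  rw [Module.finrank_fin_fun] at h
  have h1 := finrank_comap_add_finrank_map_le
    (Function.ExtendByZero.linearMap (ZMod p) (Fin.castAdd (n := n) a))
    (fun x y hxy => by
      ext i
      simpa [(Fin.castAdd_injective n a).extend_apply] using congrFun hxy (i.castAdd a))
    (LinearMap.funLeft (ZMod p) (ZMod p) (Fin.natAdd n))
    (fun x => by
      ext k
      exact Function.extend_apply' _ _ _ fun ⟨i, hi⟩ => castAdd_ne_natAdd i k hi) (rowSpan j ω)
  have h2 : (upperRight ω).rank ≤ Module.finrank (ZMod p) ((rowSpan j ω).map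
      (LinearMap.funLeft (ZMod p) (ZMod p) (Fin.natAdd n))) := by
    rw [Matrix.rank_eq_finrank_span_row]
    refine Submodule.finrank_mono (Submodule.span_le.2 ?_)
    rintro _ ⟨i, rfl⟩
    refine ⟨lapM p n a ω (i.castAdd a), Submodule.mem_sup_left (Submodule.subset_span
      ⟨_, ?_, rfl⟩), ?_⟩
    · exact Fin.lt_def.2 (i.2.trans_le (Nat.le_add_right n j))
    · ext k
      exact lapM_castAdd_natAdd ω i k
  have h3 : Module.finrank (ZMod p) (rowSpan j ω) ≤ n + j + 1 := by
    have h4 := finrank_span_image_finset_le (F := ZMod p) (lapM p n a ω)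
      (Finset.Iio (j.natAdd n))
    rw [Finset.coe_Iio, Fin.card_Iio, Fin.val_natAdd] at h4
    refine (Submodule.finrank_add_le_finrank_add_finrank _ _).trans (Nat.add_le_add h4 ?_)
    exact (finrank_span_le_card _).trans_eq (by simp)
  rw [← inSpan] at h1
  omega

theorem le_rank_upperRight (ω : LapIdx n a → ZMod p) (m : ℕ)
    (h : ∀ k : Fin a, (k : ℕ) < m → ω ∘ colBlock k ∉ colSpan k ω) (hm : m ≤ a) :
    m ≤ (upperRight ω).rank := by
  have hli : LinearIndependent (ZMod p) fun k : Fin m => ω ∘ colBlock (k.castLE hm) := by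
    refine linearIndependent_of_forall_notMem_span_lt _ fun k hk => h (k.castLE hm) k.2 ?_
    refine Submodule.span_mono ?_ hk
    rintro _ ⟨l, hl, rfl⟩
    exact ⟨_, hl, rfl⟩
  have := finrank_span_eq_card hli
  rw [Fintype.card_fin] at this
  rw [Matrix.rank_eq_finrank_span_cols]
  refine this.symm.le.trans (Submodule.finrank_mono (Submodule.span_mono ?_))
  rintro _ ⟨k, rfl⟩
  exact ⟨k.castLE hm, rfl⟩

theorem rank_firstRows_eq (ω : LapIdx n a → ZMod p) (r : ℕ) (hr : r ≤ a)
    (hout : ∀ i : Fin n, ω ∘ outBlock i ∉ outSpan i ω)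
    (hin : ∀ j : Fin a, (j : ℕ) < a - r → ω ∘ inBlock j ∉ inSpan j ω) :
    (firstRows p n a (n + a - r) (by omega) ω).rank = n + a - r := by
  have hrow : ∀ k : Fin (n + a), (k : ℕ) < n + a - r → lapM p n a ω k ∉
      Submodule.span (ZMod p) (lapM p n a ω '' {l | l < k}) := by
    intro k
    refine Fin.addCases (fun i _ => notMem_outSpan_imp ω i (hout i))
      (fun j hj => notMem_inSpan_imp ω j (hin j ?_)) k
    rw [Fin.val_natAdd] at hj
    omega
  have hli : LinearIndependent (ZMod p) (firstRows p n a (n + a - r) (by omega) ω).row := by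
    refine linearIndependent_of_forall_notMem_span_lt _ fun k hk =>
      hrow (k.castLE (by omega)) k.2 ?_
    refine Submodule.span_mono ?_ hk
    rintro _ ⟨l, hl, rfl⟩
    exact ⟨_, hl, rfl⟩
  simpa using hli.rank_matrix

end Rows

theorem sum_exp_neg_mul_sub_le {κ : ℝ} (hκ : 0 < κ) (b : ℝ) (m : ℕ) :
    ∑ k ∈ Finset.range m, Real.exp (-κ * (b - k)) ≤
      (Real.exp κ - 1)⁻¹ * Real.exp (-κ * (b - m)) := by
  have hpos : 0 < Real.exp κ - 1 := sub_pos.2 (Real.one_lt_exp_iff.2 hκ)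
  induction m with
  | zero => simp only [Finset.range_zero, Finset.sum_empty]; positivity
  | succ m ih =>
    have h : Real.exp (-κ * (b - (m + 1 : ℕ))) = Real.exp κ * Real.exp (-κ * (b - m)) := by
      rw [← Real.exp_add]
      congr 1
      push_cast
      ring
    rw [Finset.sum_range_succ, h]
    refine (add_le_add_left ih _).trans_eq ?_
    field_simp
    ring

section Probability

variable {p n a : ℕ} [Fact p.Prime] {q κ : ℝ}

theorem exists_forall_out_mem_le (hq0 : 0 < q) (hq1 : q < 1) (hκ : 0 < κ)
    (hν : ∀ t, (bern p q).real {t} ≤ Real.exp (-κ)) {ε : ℝ} (hε : 0 < ε) :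
    ∃ a₀ : ℕ, ∀ a ≥ a₀, ∀ n : ℕ, (1 / p + 2 * ε) * n ≤ a →
      (lapMeasure p n a q).real {ω | ∃ i : Fin n, ω ∘ outBlock i ∈ outSpan i ω} ≤
        Real.exp (-(ε ^ 2 / 2) * n) + n * Real.exp (-κ * (ε * n)) := by
  have := bern_isProbabilityMeasure p hq0 hq1
  obtain ⟨a₀, h⟩ := exists_forall_card_rowSum_eq_zero_le p hq0 hq1 hε
  refine ⟨a₀, fun a ha n hna => ?_⟩
  have : IsProbabilityMeasure (lapMeasure p n a q) := by unfold lapMeasure; infer_instance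
  have hsub : {ω : LapIdx n a → ZMod p | ∃ i : Fin n, ω ∘ outBlock i ∈ outSpan i ω} ⊆
      {ω | (1 / p + ε) * n ≤
        (Finset.univ.filter fun i : Fin n => ∑ k, ω (Sum.inl (i, k)) = 0).card} ∪
      ⋃ i ∈ (Finset.univ : Finset (Fin n)), {ω | ω ∘ outBlock i ∈ outSpan i ω ∧
        ε * n ≤ Module.finrank (ZMod p) ((Fin a → ZMod p) ⧸ outSpan i ω)} := by
    rintro ω ⟨i, hi⟩
    refine or_iff_not_imp_left.2 fun hZ => Set.mem_biUnion (Finset.mem_univ i) ⟨hi, ?_⟩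
    have hc : (a : ℝ) ≤ _ := Nat.cast_le.2 (le_finrank_quotient_outSpan ω i)
    rw [Set.mem_ofPred_eq, not_le] at hZ
    push_cast at hc
    linarith
  refine (measureReal_mono hsub).trans ((measureReal_union_le _ _).trans
    (add_le_add (h a ha n) ((measureReal_biUnion_finset_le _ _).trans ?_)))
  refine (Finset.sum_le_card_nsmul _ _ _ fun i _ => measureReal_pi_block_mem_le (bern p q) hκ.le hν
    (outBlock i) (outSpan i) (outSpan_congr i) _).trans_eq ?_
  simp

theorem in_mem_le (hq0 : 0 < q) (hq1 : q < 1) (hκ : 0 < κ)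
    (hν : ∀ t, (bern p q).real {t} ≤ Real.exp (-κ)) (hna : a ≤ n) {r s : ℕ} (hr : r ≤ a)
    (hs : s ≤ a) :
    (lapMeasure p n a q).real
      {ω | ∃ j : Fin a, (j : ℕ) < a - r ∧ ω ∘ inBlock j ∈ inSpan j ω} ≤
      (Real.exp κ - 1)⁻¹ * Real.exp (-κ * s) + (Real.exp κ - 1)⁻¹ * Real.exp (-κ * (r - s - 1)) := by
  have := bern_isProbabilityMeasure p hq0 hq1
  have : IsProbabilityMeasure (lapMeasure p n a q) := by unfold lapMeasure; infer_instance
  have hpos : 0 < Real.exp κ - 1 := sub_pos.2 (Real.one_lt_exp_iff.2 hκ)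
  have hsub : {ω : LapIdx n a → ZMod p |
        ∃ j : Fin a, (j : ℕ) < a - r ∧ ω ∘ inBlock j ∈ inSpan j ω} ⊆
      (⋃ k ∈ (Finset.univ : Finset (Fin (a - s))),
        {ω | ω ∘ colBlock (k.castLE (Nat.sub_le a s)) ∈ colSpan (k.castLE (Nat.sub_le a s)) ω ∧
          (n : ℝ) - (k : ℕ) ≤ Module.finrank (ZMod p)
            ((Fin n → ZMod p) ⧸ colSpan (k.castLE (Nat.sub_le a s)) ω)}) ∪
      ⋃ j ∈ (Finset.univ : Finset (Fin (a - r))),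
        {ω | ω ∘ inBlock (j.castLE (Nat.sub_le a r)) ∈ inSpan (j.castLE (Nat.sub_le a r)) ω ∧
          ((a : ℝ) - s - 1) - (j : ℕ) ≤ Module.finrank (ZMod p)
            ((Fin n → ZMod p) ⧸ inSpan (j.castLE (Nat.sub_le a r)) ω)} := by
    rintro ω ⟨j, hj, hjω⟩
    by_cases hcol : ∃ k : Fin a, (k : ℕ) < a - s ∧ ω ∘ colBlock k ∈ colSpan k ω
    · obtain ⟨k, hk, hkω⟩ := hcol
      refine Or.inl (Set.mem_biUnion (Finset.mem_univ (⟨k, hk⟩ : Fin (a - s))) ⟨hkω, ?_⟩)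
      rw [sub_le_iff_le_add]
      exact_mod_cast le_finrank_quotient_colSpan ω k
    · push Not at hcol
      refine Or.inr (Set.mem_biUnion (Finset.mem_univ (⟨j, hj⟩ : Fin (a - r))) ⟨hjω, ?_⟩)
      have h1 : ((a - s : ℕ) : ℝ) ≤ _ :=
        Nat.cast_le.2 ((le_rank_upperRight ω (a - s) hcol (Nat.sub_le a s)).trans
          (le_finrank_quotient_inSpan ω j))
      push_cast [hs] at h1
      have e : Fin.castLE (Nat.sub_le a r) ⟨j, hj⟩ = j := rfl
      rw [e]
      linarith
  refine (measureReal_mono hsub).trans ((measureReal_union_le _ _).trans (add_le_add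
    ((measureReal_biUnion_finset_le _ _).trans ?_)
    ((measureReal_biUnion_finset_le _ _).trans ?_)))
  · refine (Finset.sum_le_sum fun k _ => measureReal_pi_block_mem_le (bern p q) hκ.le hν
      (colBlock (k.castLE (Nat.sub_le a s))) (colSpan _) (colSpan_congr _) _).trans ?_
    rw [← Finset.sum_range fun k : ℕ => Real.exp (-κ * (n - k))]
    refine (sum_exp_neg_mul_sub_le hκ _ _).trans ?_
    have : (a : ℝ) ≤ n := by exact_mod_cast hna
    gcongr _ * Real.exp ?_
    push_cast [hs]
    nlinarith
  · refine (Finset.sum_le_sum fun j _ => measureReal_pi_block_mem_le (bern p q) hκ.le hν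
      (inBlock (j.castLE (Nat.sub_le a r))) (inSpan _) (inSpan_congr _) _).trans ?_
    rw [← Finset.sum_range fun k : ℕ => Real.exp (-κ * ((a : ℝ) - s - 1 - k))]
    refine (sum_exp_neg_mul_sub_le hκ _ _).trans_eq ?_
    push_cast [hr]
    ring_nf

end Probability

theorem mul_exp_neg_le {t : ℝ} (ht : 0 < t) (x : ℝ) :
    x * Real.exp (-(2 * t) * x) ≤ t⁻¹ * Real.exp (-t * x) := by
  have h1 : t * x ≤ Real.exp (t * x) := by linarith [Real.add_one_le_exp (t * x)]
  have h2 : Real.exp (-t * x) = Real.exp (t * x) * Real.exp (-(2 * t) * x) := by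
    rw [← Real.exp_add]
    ring_nf
  rw [h2, ← mul_assoc]
  gcongr
  rw [inv_mul_eq_div, le_div_iff₀ ht]
  linarith

/-- For every `0 ≤ r ≤ αn`, the first `(1+α)n - r` rows of the Laplacian of the random
directed bipartite graph have full row rank over `F_p` with probability at least
`1 - C·exp(-cr)`. -/
theorem firstRows_full_rank_trimmed
    (p : ℕ) (hp : p.Prime) (q : ℝ) (hq0 : 0 < q) (hq1 : q < 1)
    (α : ℚ) (hα1 : 1 / (p : ℚ) < α) (hα2 : α ≤ 1) :
    ∃ C > (0 : ℝ), ∃ c > (0 : ℝ), ∀ n : ℕ, 0 < n → ∀ a : ℕ, (a : ℚ) = α * n →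
      ∀ r : ℕ, r ≤ a →
        1 - C * Real.exp (-c * r) ≤
          ((lapMeasure p n a q)
            {ω | (firstRows p n a (n + a - r) (by omega) ω).rank = n + a - r}).toReal := by
  have : Fact p.Prime := ⟨hp⟩
  have := bern_isProbabilityMeasure p hq0 hq1
  obtain ⟨κ, hκ, hν⟩ := exists_bern_singleton_le p hq0 hq1
  have hα1' : 1 / (p : ℝ) < α := by
    have h := (Rat.cast_lt (K := ℝ)).2 hα1
    push_cast at h
    exact h
  obtain ⟨ε, hε, hεα⟩ : ∃ ε > (0 : ℝ), 1 / (p : ℝ) + 2 * ε = α :=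
    ⟨((α : ℝ) - 1 / p) / 2, by linarith, by ring⟩
  obtain ⟨a₀, hout⟩ := exists_forall_out_mem_le (p := p) hq0 hq1 hκ hν hε
  set G : ℝ := (Real.exp κ - 1)⁻¹
  have hG : 0 < G := inv_pos.2 (sub_pos.2 (Real.one_lt_exp_iff.2 hκ))
  set t : ℝ := κ * ε / 2 with ht
  have ht0 : 0 < t := by positivity
  set c : ℝ := min (κ / 2) (min (ε ^ 2 / 2) t)
  have hc : 0 < c := by positivity
  have hcκ : c ≤ κ / 2 := min_le_left _ _
  have hcε : c ≤ ε ^ 2 / 2 := (min_le_right _ _).trans (min_le_left _ _)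
  have hct : c ≤ t := (min_le_right _ _).trans (min_le_right _ _)
  refine ⟨Real.exp (c * a₀) + 1 + t⁻¹ + 2 * G * Real.exp κ, by positivity, c, hc, ?_⟩
  intro n hn a ha r hr
  have : IsProbabilityMeasure (lapMeasure p n a q) := by unfold lapMeasure; infer_instance
  have ha' : (a : ℝ) = α * n := by exact_mod_cast ha
  have hα2' : (α : ℝ) ≤ 1 := by exact_mod_cast hα2
  have hanR : (a : ℝ) ≤ n := by
    rw [ha']
    exact mul_le_of_le_one_left (Nat.cast_nonneg n) hα2'
  have han : a ≤ n := by exact_mod_cast hanR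
  have hrR : (r : ℝ) ≤ a := by exact_mod_cast hr
  rw [← measureReal_def]
  rcases lt_or_ge a a₀ with hlt | hge
  · have h1 : 1 ≤ Real.exp (c * a₀) * Real.exp (-c * r) := by
      rw [← Real.exp_add, Real.one_le_exp_iff]
      have : (a : ℝ) ≤ a₀ := by exact_mod_cast hlt.le
      nlinarith
    have h2 : 0 ≤ (1 + t⁻¹ + 2 * G * Real.exp κ) * Real.exp (-c * r) := by positivity
    refine le_trans ?_ measureReal_nonneg
    linarith
  have hO := hout a hge n (by rw [hεα, ha'])
  have hI := in_mem_le (p := p) hq0 hq1 hκ hν han hr ((Nat.div_le_self r 2).trans hr)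
  have hrn : (r : ℝ) ≤ n := hrR.trans hanR
  have hr0 : (0 : ℝ) ≤ r := Nat.cast_nonneg r
  have e1 : Real.exp (-(ε ^ 2 / 2) * n) ≤ Real.exp (-c * r) := by
    refine Real.exp_le_exp.2 ?_
    nlinarith
  have e2 : n * Real.exp (-κ * (ε * n)) ≤ t⁻¹ * Real.exp (-c * r) := by
    have h := mul_exp_neg_le ht0 n
    rw [show -(2 * t) * (n : ℝ) = -κ * (ε * n) by rw [ht]; ring] at h
    refine h.trans ?_
    gcongr _ * Real.exp ?_
    nlinarith
  have hs1 : (r : ℝ) / 2 - 1 ≤ (r / 2 : ℕ) := by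
    have : r ≤ 2 * (r / 2) + 1 := by omega
    have : (r : ℝ) ≤ 2 * (r / 2 : ℕ) + 1 := by exact_mod_cast this
    linarith
  have hs2 : ((r / 2 : ℕ) : ℝ) ≤ r / 2 := Nat.cast_div_le
  have e3 : ∀ y : ℝ, (r : ℝ) / 2 - 1 ≤ y →
      G * Real.exp (-κ * y) ≤ G * Real.exp κ * Real.exp (-c * r) := by
    intro y hy
    rw [mul_assoc, ← Real.exp_add]
    gcongr _ * Real.exp ?_
    nlinarith
  have e4 := e3 _ hs1
  have e5 := e3 (r - (r / 2 : ℕ) - 1) (by linarith)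
  set good : Set (LapIdx n a → ZMod p) :=
    {ω | (firstRows p n a (n + a - r) (by omega) ω).rank = n + a - r}
  have hcompl : goodᶜ ⊆ {ω | ∃ i : Fin n, ω ∘ outBlock i ∈ outSpan i ω} ∪
      {ω | ∃ j : Fin a, (j : ℕ) < a - r ∧ ω ∘ inBlock j ∈ inSpan j ω} := by
    intro ω hω
    by_contra hcon
    rw [Set.mem_union, not_or] at hcon
    refine hω (rank_firstRows_eq ω r hr (fun i hi => hcon.1 ⟨i, hi⟩)
      fun j hj hjω => hcon.2 ⟨j, hj, hjω⟩)
  have hbad := (measureReal_mono (μ := lapMeasure p n a q) hcompl).trans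
    (measureReal_union_le _ _)
  rw [probReal_compl_eq_one_sub (Set.toFinite good).measurableSet] at hbad
  have e0 : 0 ≤ Real.exp (c * a₀) * Real.exp (-c * r) := by positivity
  linarith
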